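/- Let N ≥ 2 be even and let k ≥ 1, 0 ≤ l ≤ k, 0 ≤ r ≤ k be integers with l + r ≤ k. Then, in the field ℚ(q,z), the lattice-point generating polynomial satisfies p_N(k,l,r;q,z) = d^o_N(k,l,r;q,z). -/

import Mathlib

/-!
STATEMENT 9: For even N ≥ 2 and 1 ≤ k, 0 ≤ l ≤ k, 0 ≤ r ≤ k with l + r ≤ k,
p_N(k,l,r;q,z) = d^o_N(k,l,r;q,z) in ℚ(q,z).
-/

open MvPolynomial

noncomputable section

/-- The field `ℚ(q,z)` of rational functions in two variables. -/
abbrev K := FractionRing (MvPolynomial (Fin 2) ℚ)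

/-- The variable `q` as an element of `ℚ(q,z)`. -/
def qK : K := algebraMap (MvPolynomial (Fin 2) ℚ) K (X 0)

/-- The variable `z` as an element of `ℚ(q,z)`. -/
def zK : K := algebraMap (MvPolynomial (Fin 2) ℚ) K (X 1)

def phiQ (N : ℕ) (a : Fin N → ℤ) : ℤ := ∑ t : Fin N, (t.1 + 1 : ℤ) * a t
def phiZ (N : ℕ) (a : Fin N → ℤ) : ℤ := ∑ t : Fin N, a t

/-- The vertex `M_{m,n}` (coordinates 1-indexed in the paper; `j : Fin N`
is the coordinate `j.1 + 1`). -/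
def Mvec (N : ℕ) (k l r : ℤ) (m n : ℕ) (j : Fin N) : ℤ :=
  if j.1 + 1 ≤ m then (if (j.1 + 1) % 2 = 1 then l else k - l)
  else if N - n < j.1 + 1 then (if (N - j.1) % 2 = 1 then r else k - r)
  else 0

/-- The contribution `d^{m,n}_N(k,l,r;q,z)` of the vertex `M_{m,n}`, in `ℚ(q,z)`. -/
def dmn (N : ℕ) (k l r : ℤ) (m n : ℕ) : K :=
  qK ^ phiQ N (Mvec N k l r m n) * zK ^ phiZ N (Mvec N k l r m n) /
    ((∏ i ∈ Finset.Icc 1 (m / 2), (1 - qK ^ (i : ℤ))) *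
     (∏ i ∈ Finset.Icc (m / 2 + 1) m, (1 - qK ^ (-(i : ℤ)) * zK⁻¹)) *
     (∏ i ∈ Finset.Icc (m + 1) (N - n), (1 - qK ^ (i : ℤ) * zK)) *
     (∏ i ∈ Finset.Icc 1 (n / 2), (1 - qK ^ (-(i : ℤ)))) *
     (∏ i ∈ Finset.Icc (n / 2 + 1) n, (1 - qK ^ ((i : ℤ) - N - 1) * zK⁻¹)))

/-- `d^e_N(k,l,r;q,z)`: sum of `d^{m,n}_N` over `m, n ≥ 0` with `m+n < N`, or
`m+n = N` and `m` even. -/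
def dE (N : ℕ) (k l r : ℤ) : K :=
  ∑ p ∈ (Finset.range (N + 1) ×ˢ Finset.range (N + 1)).filter
      (fun p => p.1 + p.2 < N ∨ (p.1 + p.2 = N ∧ Even p.1)),
    dmn N k l r p.1 p.2

/-- `d^o_N(k,l,r;q,z)`: sum of `d^{m,n}_N` over `m, n ≥ 0` with `m+n < N`, or
`m+n = N` and `m` odd. -/
def dO (N : ℕ) (k l r : ℤ) : K :=
  ∑ p ∈ (Finset.range (N + 1) ×ˢ Finset.range (N + 1)).filter
      (fun p => p.1 + p.2 < N ∨ (p.1 + p.2 = N ∧ Odd p.1)),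
    dmn N k l r p.1 p.2

/-- The set `A_N(k,l,r)` of lattice points of the polyhedron `P_N(k,l,r)`. -/
def ASet (N : ℕ) (k l r : ℤ) : Set (Fin N → ℤ) :=
  {a | (∀ i, 0 ≤ a i) ∧
       (∀ h : 0 < N, a ⟨0, h⟩ ≤ l) ∧
       (∀ h : 0 < N, a ⟨N - 1, Nat.sub_lt h Nat.one_pos⟩ ≤ r) ∧
       (∀ (t : Fin N) (h : t.1 + 1 < N), a t + a ⟨t.1 + 1, h⟩ ≤ k)}

/-- The lattice-point generating polynomial `p_N(k,l,r;q,z) = ∑_{a ∈ A_N(k,l,r)}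
q^{φ_q(a)} z^{φ_z(a)}`, regarded as an element of `ℚ(q,z)` (the set `A_N(k,l,r)`
is finite, and `∑ᶠ` is the sum over it). -/
def pPoly (N : ℕ) (k l r : ℤ) : K :=
  ∑ᶠ a ∈ ASet N k l r, qK ^ phiQ N a * zK ^ phiZ N a

variable {F : Type*} [Field F]

/-- The pair `(q, z)` avoids all zeros and poles of the factors `1 - q ^ i` and `1 - q ^ i * z`. -/
structure IsGenericPair (q z : F) : Prop where
  q_ne_zero : q ≠ 0
  z_ne_zero : z ≠ 0
  pow_ne_one : ∀ i : ℕ, i ≠ 0 → q ^ i ≠ 1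
  zpow_mul_ne_one : ∀ i : ℤ, q ^ i * z ≠ 1

theorem IsGenericPair.shift {q z : F} (h : IsGenericPair q z) (c : ℤ) :
    IsGenericPair q (q ^ c * z) where
  q_ne_zero := h.q_ne_zero
  z_ne_zero := mul_ne_zero (zpow_ne_zero _ h.q_ne_zero) h.z_ne_zero
  pow_ne_one := h.pow_ne_one
  zpow_mul_ne_one i := by
    rw [← mul_assoc, ← zpow_add₀ h.q_ne_zero]
    exact h.zpow_mul_ne_one _

theorem IsGenericPair.inv {q z : F} (h : IsGenericPair q z) : IsGenericPair q⁻¹ z where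
  q_ne_zero := inv_ne_zero h.q_ne_zero
  z_ne_zero := h.z_ne_zero
  pow_ne_one i hi := by
    rw [inv_pow, Ne, inv_eq_one]
    exact h.pow_ne_one i hi
  zpow_mul_ne_one i := by
    rw [inv_zpow, ← zpow_neg]
    exact h.zpow_mul_ne_one _

theorem IsGenericPair.reflect {q z : F} (h : IsGenericPair q z) (N : ℕ) :
    IsGenericPair q⁻¹ (q ^ (N + 1 : ℤ) * z) :=
  (h.shift _).inv

/-- The monomial `q ^ φ_q(a) * z ^ φ_z(a)`. -/
def latticeMonomial (q z : F) {N : ℕ} (a : Fin N → ℤ) : F :=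
  q ^ phiQ N a * z ^ phiZ N a

theorem phiQ_cons {N : ℕ} (a : ℤ) (v : Fin N → ℤ) :
    phiQ (N + 1) (Fin.cons a v : Fin (N + 1) → ℤ) = a + (phiQ N v + phiZ N v) := by
  simp [phiQ, phiZ, Fin.sum_univ_succ, ← Finset.sum_add_distrib, add_mul]

theorem phiZ_cons {N : ℕ} (a : ℤ) (v : Fin N → ℤ) :
    phiZ (N + 1) (Fin.cons a v : Fin (N + 1) → ℤ) = a + phiZ N v := by
  simp [phiZ, Fin.sum_univ_succ]

theorem phiZ_rev {N : ℕ} (v : Fin N → ℤ) : phiZ N (v ∘ Fin.rev) = phiZ N v :=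
  Equiv.sum_comp Fin.revPerm v

theorem phiQ_rev {N : ℕ} (v : Fin N → ℤ) :
    phiQ N (v ∘ Fin.rev) = (N + 1) * phiZ N v - phiQ N v := by
  have h : phiQ N (v ∘ Fin.rev) = ∑ t : Fin N, ((Fin.rev t).1 + 1 : ℤ) * v t := by
    rw [phiQ, ← Equiv.sum_comp Fin.revPerm]
    simp
  rw [h, phiZ, phiQ, Finset.mul_sum, ← Finset.sum_sub_distrib]
  refine Finset.sum_congr rfl fun t _ => ?_
  have ht := t.2
  rw [Fin.val_rev, Nat.cast_sub (by omega)]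
  push_cast
  ring

theorem latticeMonomial_ne_zero {q z : F} (h : IsGenericPair q z) {N : ℕ} (a : Fin N → ℤ) :
    latticeMonomial q z a ≠ 0 :=
  mul_ne_zero (zpow_ne_zero _ h.q_ne_zero) (zpow_ne_zero _ h.z_ne_zero)

theorem latticeMonomial_cons {q z : F} (h : IsGenericPair q z) {N : ℕ} (a : ℤ)
    (v : Fin N → ℤ) :
    latticeMonomial q z (Fin.cons a v : Fin (N + 1) → ℤ) =
      (q * z) ^ a * latticeMonomial q (q * z) v := by
  simp only [latticeMonomial, phiQ_cons, phiZ_cons, mul_zpow, zpow_add₀ h.q_ne_zero,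
    zpow_add₀ h.z_ne_zero]
  ring

theorem latticeMonomial_add {q z : F} (h : IsGenericPair q z) {N : ℕ} (v w : Fin N → ℤ) :
    latticeMonomial q z (v + w) = latticeMonomial q z v * latticeMonomial q z w := by
  have hQ : phiQ N (v + w) = phiQ N v + phiQ N w := by
    simp [phiQ, mul_add, Finset.sum_add_distrib]
  have hZ : phiZ N (v + w) = phiZ N v + phiZ N w := by
    simp [phiZ, Finset.sum_add_distrib]
  simp only [latticeMonomial, hQ, hZ, zpow_add₀ h.q_ne_zero, zpow_add₀ h.z_ne_zero]
  ring

theorem latticeMonomial_rev {q z : F} (h : IsGenericPair q z) {N : ℕ} (v : Fin N → ℤ) :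
    latticeMonomial q⁻¹ (q ^ (N + 1 : ℤ) * z) (v ∘ Fin.rev) = latticeMonomial q z v := by
  simp only [latticeMonomial, phiQ_rev, phiZ_rev, mul_zpow, inv_zpow, ← zpow_neg, ← zpow_mul]
  rw [← mul_assoc, ← zpow_add₀ h.q_ne_zero]
  congr 2
  ring

/-- The vector `(1, -1, 1, -1, …)` of length `m`, padded by zeros. -/
def altVec (N m : ℕ) (j : Fin N) : ℤ := if j.1 < m then (-1) ^ j.1 else 0

theorem sum_range_alternating (m : ℕ) :
    ∑ j ∈ Finset.range m, ((-1) ^ j : ℤ) = if Even m then 0 else 1 := by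
  induction m with
  | zero => simp
  | succ m ih =>
    rw [Finset.sum_range_succ, ih]
    rcases Nat.even_or_odd m with hm | hm
    · simp [hm, hm.neg_one_pow, Nat.even_add_one]
    · simp [Nat.not_even_iff_odd.2 hm, hm.neg_one_pow, Nat.even_add_one]

theorem sum_range_mul_alternating (m : ℕ) :
    ∑ j ∈ Finset.range m, ((j + 1 : ℤ) * (-1) ^ j) =
      if Even m then -((m / 2 : ℕ) : ℤ) else ((m / 2 + 1 : ℕ) : ℤ) := by
  induction m with
  | zero => simp
  | succ m ih =>
    rw [Finset.sum_range_succ, ih]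
    rcases Nat.even_or_odd m with hm | hm
    · simp only [hm, hm.neg_one_pow, Nat.even_add_one]
      obtain ⟨j, rfl⟩ := hm
      simp
      omega
    · simp only [Nat.not_even_iff_odd.2 hm, hm.neg_one_pow, Nat.even_add_one]
      obtain ⟨j, rfl⟩ := hm
      simp
      omega

theorem phiZ_altVec {N m : ℕ} (h : m ≤ N) :
    phiZ N (altVec N m) = if Even m then 0 else 1 := by
  rw [← sum_range_alternating, phiZ]
  simp only [altVec]
  rw [Fin.sum_univ_eq_sum_range (fun j => if j < m then ((-1) ^ j : ℤ) else 0) N,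
    ← Finset.sum_filter]
  congr 1
  ext j
  simp
  omega

theorem phiQ_altVec {N m : ℕ} (h : m ≤ N) :
    phiQ N (altVec N m) = if Even m then -((m / 2 : ℕ) : ℤ) else ((m / 2 + 1 : ℕ) : ℤ) := by
  rw [← sum_range_mul_alternating, phiQ]
  simp only [altVec, mul_ite, mul_zero]
  rw [Fin.sum_univ_eq_sum_range (fun j => if j < m then ((j + 1 : ℤ) * (-1) ^ j) else 0) N,
    ← Finset.sum_filter]
  congr 1
  ext j
  simp
  omega

theorem latticeMonomial_altVec_even (q z : F) {N j : ℕ} (h : 2 * j ≤ N) :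
    latticeMonomial q z (altVec N (2 * j)) = q ^ (-(j : ℤ)) := by
  rw [latticeMonomial, phiZ_altVec h, phiQ_altVec h]
  simp

theorem latticeMonomial_altVec_odd (q z : F) {N j : ℕ} (h : 2 * j + 1 ≤ N) :
    latticeMonomial q z (altVec N (2 * j + 1)) = q ^ (j + 1 : ℤ) * z := by
  have hj : (2 * j + 1) / 2 = j := by omega
  rw [latticeMonomial, phiZ_altVec h, phiQ_altVec h, hj]
  simp

theorem latticeMonomial_altVec_ne_one {q z : F} (hg : IsGenericPair q z) {N m : ℕ}
    (h : m ≤ N) (hm : m ≠ 0) : latticeMonomial q z (altVec N m) ≠ 1 := by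
  obtain ⟨j, rfl | rfl⟩ := Nat.even_or_odd' m
  · rw [latticeMonomial_altVec_even q z h, zpow_neg, zpow_natCast, Ne, inv_eq_one]
    exact hg.pow_ne_one j (by omega)
  · rw [latticeMonomial_altVec_odd q z h]
    exact hg.zpow_mul_ne_one _

/-- The denominator of `dmn`, over an arbitrary field. -/
def vertexDenom (q z : F) (N m n : ℕ) : F :=
  (∏ i ∈ Finset.Icc 1 (m / 2), (1 - q ^ (i : ℤ))) *
  (∏ i ∈ Finset.Icc (m / 2 + 1) m, (1 - q ^ (-(i : ℤ)) * z⁻¹)) *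
  (∏ i ∈ Finset.Icc (m + 1) (N - n), (1 - q ^ (i : ℤ) * z)) *
  (∏ i ∈ Finset.Icc 1 (n / 2), (1 - q ^ (-(i : ℤ)))) *
  (∏ i ∈ Finset.Icc (n / 2 + 1) n, (1 - q ^ ((i : ℤ) - N - 1) * z⁻¹))

/-- The vertex contribution `dmn`, over an arbitrary field. -/
def vertexTerm (q z : F) (N : ℕ) (k l r : ℤ) (m n : ℕ) : F :=
  latticeMonomial q z (Mvec N k l r m n) / vertexDenom q z N m n

/-- The pairs `(m, n)` with `m + n < N`, or `m + n = N` and `m + b` even. -/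
def vertexIndex (N b : ℕ) : Finset (ℕ × ℕ) :=
  (Finset.range (N + 1) ×ˢ Finset.range (N + 1)).filter
    (fun p => p.1 + p.2 < N ∨ (p.1 + p.2 = N ∧ Even (p.1 + b)))

/-- The sums `dE` (for `b` even) and `dO` (for `b` odd), over an arbitrary field. -/
def vertexSum (q z : F) (N b : ℕ) (k l r : ℤ) : F :=
  ∑ p ∈ vertexIndex N b, vertexTerm q z N k l r p.1 p.2

/-- The lattice-point generating function `pPoly`, over an arbitrary field. -/
def latticeSum (q z : F) (N : ℕ) (k l r : ℤ) : F :=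
  ∑ᶠ a ∈ ASet N k l r, latticeMonomial q z a

theorem mem_vertexIndex {N b : ℕ} {p : ℕ × ℕ} :
    p ∈ vertexIndex N b ↔ p.1 + p.2 < N ∨ (p.1 + p.2 = N ∧ Even (p.1 + b)) := by
  simp only [vertexIndex, Finset.mem_filter, Finset.mem_product, Finset.mem_range]
  constructor
  · exact fun h => h.2
  · intro h
    exact ⟨by omega, h⟩

theorem prod_Icc_succ_succ (f : ℕ → F) (a b : ℕ) :
    ∏ i ∈ Finset.Icc (a + 1) (b + 1), f i = ∏ i ∈ Finset.Icc a b, f (i + 1) := by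
  rw [← Finset.map_add_right_Icc, Finset.prod_map]
  rfl

theorem Mvec_cons {N m n : ℕ} (h : m + n ≤ N) (k l r : ℤ) :
    Mvec (N + 1) k l r (m + 1) n =
      (Fin.cons l (Mvec N k (k - l) r m n) : Fin (N + 1) → ℤ) := by
  funext j
  refine Fin.cases ?_ (fun j => ?_) j
  · simp [Mvec]
  · simp only [Fin.cons_succ, Mvec, Fin.val_succ]
    split_ifs <;> omega

theorem Mvec_rev {N m n : ℕ} (h : m + n ≤ N) (k l r : ℤ) :
    Mvec N k r l n m = Mvec N k l r m n ∘ Fin.rev := by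
  funext j
  have hj := j.2
  simp only [Function.comp, Mvec, Fin.val_rev]
  split_ifs <;> omega

theorem Mvec_pred_left (N : ℕ) (k l r : ℤ) (m n : ℕ) :
    Mvec N k l r m n = Mvec N k (l - 1) r m n + altVec N m := by
  funext j
  simp only [Pi.add_apply, Mvec, altVec]
  rcases Nat.even_or_odd j.1 with hj | hj
  · rw [hj.neg_one_pow]
    rw [Nat.even_iff] at hj
    split_ifs <;> omega
  · rw [hj.neg_one_pow]
    rw [Nat.odd_iff] at hj
    split_ifs <;> omega

theorem vertexDenom_succ {q z : F} (hg : IsGenericPair q z) {N m n : ℕ} (h : m + n ≤ N) :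
    vertexDenom q z (N + 1) (m + 1) n =
      (1 - (latticeMonomial q z (altVec (N + 1) (m + 1)))⁻¹) * vertexDenom q (q * z) N m n := by
  have hq := hg.q_ne_zero
  have e1 : ∀ i : ℤ, q ^ (-i) * (q * z)⁻¹ = q ^ (-(i + 1)) * z⁻¹ := fun i => by
    rw [mul_inv, neg_add, zpow_add₀ hq, zpow_neg_one, mul_assoc]
  have e2 : ∀ i : ℤ, q ^ i * (q * z) = q ^ (i + 1) * z := fun i => by
    rw [zpow_add_one₀ hq, mul_assoc]
  have e3 : ∀ i : ℤ, q ^ (i - N - 1) * (q * z)⁻¹ = q ^ (i - (N + 1 : ℕ) - 1) * z⁻¹ := fun i => by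
    have := e1 (-(i - N - 1))
    rw [neg_neg] at this
    rw [this]
    congr 2
    push_cast
    ring
  have hmid : ∏ i ∈ Finset.Icc (m + 1 + 1) (N + 1 - n), (1 - q ^ (i : ℤ) * z) =
      ∏ i ∈ Finset.Icc (m + 1) (N - n), (1 - q ^ (i : ℤ) * (q * z)) := by
    rw [show N + 1 - n = N - n + 1 by omega, prod_Icc_succ_succ]
    simp only [e2, Nat.cast_add, Nat.cast_one]
  have hneg : ∀ a b : ℕ, ∏ i ∈ Finset.Icc (a + 1) (b + 1), (1 - q ^ (-(i : ℤ)) * z⁻¹) =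
      ∏ i ∈ Finset.Icc a b, (1 - q ^ (-(i : ℤ)) * (q * z)⁻¹) := fun a b => by
    rw [prod_Icc_succ_succ]
    simp only [e1, Nat.cast_add, Nat.cast_one]
  rw [vertexDenom, vertexDenom, hmid]
  simp only [e3]
  obtain ⟨j, rfl | rfl⟩ := Nat.even_or_odd' m
  · rw [latticeMonomial_altVec_odd q z (by omega), show (2 * j + 1) / 2 = j by omega,
      show 2 * j / 2 = j by omega, mul_inv, ← zpow_neg,
      ← Finset.mul_prod_Ioc_eq_prod_Icc (show j + 1 ≤ 2 * j + 1 by omega),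
      ← Finset.Icc_add_one_left_eq_Ioc, hneg]
    push_cast
    ring
  · rw [show 2 * j + 1 + 1 = 2 * (j + 1) by ring, latticeMonomial_altVec_even q z (by omega),
      show 2 * (j + 1) / 2 = j + 1 by omega, show (2 * j + 1) / 2 = j by omega,
      show 2 * (j + 1) = (2 * j + 1) + 1 by ring, hneg,
      Finset.prod_Icc_succ_top (by omega), ← zpow_neg, neg_neg]
    push_cast
    ring

theorem vertexTerm_succ_sub {q z : F} (hg : IsGenericPair q z) {N m n : ℕ} (h : m + n ≤ N)
    (k l r : ℤ) :
    vertexTerm q z (N + 1) k l r (m + 1) n - vertexTerm q z (N + 1) k (l - 1) r (m + 1) n =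
      (q * z) ^ l * vertexTerm q (q * z) N k (k - l) r m n := by
  have hx0 := latticeMonomial_ne_zero hg (altVec (N + 1) (m + 1))
  have hx1 := latticeMonomial_altVec_ne_one hg (show m + 1 ≤ N + 1 by omega) (by omega)
  have hd := vertexDenom_succ hg h
  have hnum := latticeMonomial_cons hg l (Mvec N k (k - l) r m n)
  rw [← Mvec_cons h] at hnum
  have hstep := latticeMonomial_add hg (Mvec (N + 1) k (l - 1) r (m + 1) n)
    (altVec (N + 1) (m + 1))
  rw [← Mvec_pred_left] at hstep
  set x := latticeMonomial q z (altVec (N + 1) (m + 1))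
  have hx2 : 1 - x⁻¹ ≠ 0 := by
    rw [sub_ne_zero]
    exact fun h => hx1 (inv_eq_one.1 h.symm)
  have hprev : latticeMonomial q z (Mvec (N + 1) k (l - 1) r (m + 1) n) =
      latticeMonomial q z (Mvec (N + 1) k l r (m + 1) n) * x⁻¹ := by
    rw [hstep, mul_inv_cancel_right₀ hx0]
  rw [vertexTerm, vertexTerm, vertexTerm, hprev, ← sub_div, ← mul_one_sub, hd, mul_comm,
    mul_div_mul_left _ _ hx2, hnum, mul_div_assoc]

theorem vertexTerm_zero_left (q z : F) (N n : ℕ) (k l l' r : ℤ) :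
    vertexTerm q z N k l r 0 n = vertexTerm q z N k l' r 0 n := by
  have h : Mvec N k l r 0 n = Mvec N k l' r 0 n := by
    funext j
    simp [Mvec]
  rw [vertexTerm, vertexTerm, h]

theorem vertexSum_succ_sub {q z : F} (hg : IsGenericPair q z) (N b : ℕ) (k l r : ℤ) :
    vertexSum q z (N + 1) b k l r - vertexSum q z (N + 1) b k (l - 1) r =
      (q * z) ^ l * vertexSum q (q * z) N (b + 1) k (k - l) r := by
  rw [vertexSum, vertexSum, vertexSum, ← Finset.sum_sub_distrib, Finset.mul_sum]
  symm
  refine Finset.sum_of_injOn (fun p => (p.1 + 1, p.2)) ?_ ?_ ?_ ?_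
  · rintro ⟨a, b⟩ _ ⟨c, d⟩ _ h
    simpa using h
  · rintro ⟨m, n⟩ h
    simp only [Finset.mem_coe, mem_vertexIndex, Nat.even_iff] at h ⊢
    omega
  · rintro ⟨m, n⟩ h h'
    cases m with
    | zero => rw [vertexTerm_zero_left q z (N + 1) n k l (l - 1), sub_self]
    | succ m =>
      refine absurd ⟨(m, n), ?_, rfl⟩ h'
      simp only [Finset.mem_coe, mem_vertexIndex, Nat.even_iff] at h ⊢
      omega
  · rintro ⟨m, n⟩ h
    rw [mem_vertexIndex] at h
    exact (vertexTerm_succ_sub hg (by simp only at h; omega) k l r).symm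

theorem vertexTerm_neg_one_pair {q z : F} (hg : IsGenericPair q z) {N j n : ℕ}
    (h : 2 * j + n < N) (k r : ℤ) :
    vertexTerm q z N k (-1) r (2 * j) n + vertexTerm q z N k (-1) r (2 * j + 1) n = 0 := by
  have hq := hg.q_ne_zero
  have hz := hg.z_ne_zero
  have hA : (1 : F) - q ^ ((2 * j + 1 : ℕ) : ℤ) * z ≠ 0 :=
    sub_ne_zero.2 (hg.zpow_mul_ne_one _).symm
  have hzp : q ^ ((2 * j + 1 : ℕ) : ℤ) ≠ 0 := zpow_ne_zero _ hq
  have hB : (1 : F) - q ^ (-((2 * j + 1 : ℕ) : ℤ)) * z⁻¹ ≠ 0 := by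
    rw [zpow_neg, ← mul_inv, sub_ne_zero]
    exact fun h => hg.zpow_mul_ne_one _ (inv_eq_one.1 h.symm)
  have hnum : latticeMonomial q z (Mvec N k (-1) r (2 * j) n) =
      latticeMonomial q z (Mvec N k (-1) r (2 * j + 1) n) * (q ^ ((2 * j + 1 : ℕ) : ℤ) * z) := by
    have hv : Mvec N k (-1) r (2 * j) n =
        Mvec N k (-1) r (2 * j + 1) n + Pi.single ⟨2 * j, by omega⟩ 1 := by
      funext i
      simp only [Pi.add_apply, Mvec, Pi.single_apply, Fin.ext_iff]
      split_ifs <;> omega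
    rw [hv, latticeMonomial_add hg]
    congr 1
    simp [latticeMonomial, phiQ, phiZ, Pi.single_apply]
  rw [vertexTerm, vertexTerm, hnum, vertexDenom, vertexDenom,
    show (2 * j + 1) / 2 = j by omega, show 2 * j / 2 = j by omega,
    Finset.prod_Icc_succ_top (show j + 1 ≤ 2 * j + 1 by omega),
    ← Finset.mul_prod_Ioc_eq_prod_Icc (show 2 * j + 1 ≤ N - n by omega),
    ← Finset.Icc_add_one_left_eq_Ioc]
  have hratio : q ^ ((2 * j + 1 : ℕ) : ℤ) * z * (1 - q ^ (-((2 * j + 1 : ℕ) : ℤ)) * z⁻¹) =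
      -(1 - q ^ ((2 * j + 1 : ℕ) : ℤ) * z) := by
    rw [zpow_neg]
    field_simp
    ring
  generalize q ^ ((2 * j + 1 : ℕ) : ℤ) * z = y at *
  generalize (1 : F) - q ^ (-((2 * j + 1 : ℕ) : ℤ)) * z⁻¹ = w at *
  have hsum : y / (1 - y) + 1 / w = 0 := by
    rw [div_add_div _ _ hA hB, hratio]
    ring
  calc _ = (y / (1 - y) + 1 / w) *
        (latticeMonomial q z (Mvec N k (-1) r (2 * j + 1) n) /
          ((∏ i ∈ Finset.Icc 1 j, (1 - q ^ (i : ℤ))) *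
          (∏ i ∈ Finset.Icc (j + 1) (2 * j), (1 - q ^ (-(i : ℤ)) * z⁻¹)) *
          (∏ i ∈ Finset.Icc (2 * j + 1 + 1) (N - n), (1 - q ^ (i : ℤ) * z)) *
          (∏ i ∈ Finset.Icc 1 (n / 2), (1 - q ^ (-(i : ℤ)))) *
          (∏ i ∈ Finset.Icc (n / 2 + 1) n, (1 - q ^ ((i : ℤ) - N - 1) * z⁻¹)))) := by
        simp only [div_eq_mul_inv, mul_inv]
        ring
    _ = 0 := by rw [hsum, zero_mul]

theorem vertexSum_neg_one {q z : F} (hg : IsGenericPair q z) (N : ℕ) (k r : ℤ) :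
    vertexSum q z N 1 k (-1) r = 0 := by
  refine Finset.sum_involution
    (fun p _ => (if Even p.1 then p.1 + 1 else p.1 - 1, p.2)) ?_ ?_ ?_ ?_
  · rintro ⟨m, n⟩ h
    simp only [mem_vertexIndex, Nat.even_iff] at h
    obtain ⟨j, rfl | rfl⟩ := Nat.even_or_odd' m
    · simpa using vertexTerm_neg_one_pair hg (show 2 * j + n < N by omega) k r
    · rw [add_comm]
      simpa [Nat.even_add_one] using
        vertexTerm_neg_one_pair hg (show 2 * j + n < N by omega) k r
  · rintro ⟨m, n⟩ _ _
    simp only [Nat.even_iff, ne_eq, Prod.mk.injEq, not_and]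
    split_ifs <;> omega
  · rintro ⟨m, n⟩ h
    simp only [mem_vertexIndex, Nat.even_iff] at h ⊢
    split_ifs <;> omega
  · rintro ⟨m, n⟩ _
    simp only [Nat.even_iff, Prod.mk.injEq, and_true]
    split_ifs <;> omega

theorem vertexDenom_reflect {q z : F} (hg : IsGenericPair q z) {N m n : ℕ} (h : m + n ≤ N) :
    vertexDenom q⁻¹ (q ^ (N + 1 : ℤ) * z) N n m = vertexDenom q z N m n := by
  have hq := hg.q_ne_zero
  have e1 : ∀ i : ℤ, q ^ i * (q ^ (N + 1 : ℤ) * z)⁻¹ = q ^ (i - N - 1) * z⁻¹ := fun i => by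
    rw [mul_inv, ← zpow_neg, ← mul_assoc, ← zpow_add₀ hq]
    congr 2
    ring
  have hmid : ∏ i ∈ Finset.Icc (n + 1) (N - m), (1 - q ^ (-(i : ℤ)) * (q ^ (N + 1 : ℤ) * z)) =
      ∏ i ∈ Finset.Icc (m + 1) (N - n), (1 - q ^ (i : ℤ) * z) := by
    refine Finset.prod_nbij' (fun i => N + 1 - i) (fun i => N + 1 - i) ?_ ?_ ?_ ?_ ?_
    · intro i hi
      rw [Finset.mem_Icc] at hi ⊢
      omega
    · intro i hi
      rw [Finset.mem_Icc] at hi ⊢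
      omega
    · intro i hi
      rw [Finset.mem_Icc] at hi
      omega
    · intro i hi
      rw [Finset.mem_Icc] at hi
      omega
    · intro i hi
      rw [Finset.mem_Icc] at hi
      rw [← mul_assoc, ← zpow_add₀ hq, Nat.cast_sub (by omega)]
      congr 3
      push_cast
      ring
  have e2 : ∀ i : ℤ, -(i - N - 1) - N - 1 = -i := fun i => by ring
  simp only [vertexDenom, inv_zpow, ← zpow_neg, neg_neg, hmid, e1, e2]
  ring

theorem vertexTerm_reflect {q z : F} (hg : IsGenericPair q z) {N m n : ℕ} (h : m + n ≤ N)
    (k l r : ℤ) :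
    vertexTerm q⁻¹ (q ^ (N + 1 : ℤ) * z) N k r l n m = vertexTerm q z N k l r m n := by
  rw [vertexTerm, vertexTerm, vertexDenom_reflect hg h, Mvec_rev h, latticeMonomial_rev hg]

theorem vertexSum_reflect {q z : F} (hg : IsGenericPair q z) (N b : ℕ) (k l r : ℤ) :
    vertexSum q⁻¹ (q ^ (N + 1 : ℤ) * z) N (b + N) k r l = vertexSum q z N b k l r := by
  refine Finset.sum_nbij' Prod.swap Prod.swap ?_ ?_ (fun _ _ => rfl) (fun _ _ => rfl) ?_
  · rintro ⟨m, n⟩ h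
    simp only [mem_vertexIndex, Nat.even_iff, Prod.swap] at h ⊢
    omega
  · rintro ⟨m, n⟩ h
    simp only [mem_vertexIndex, Nat.even_iff, Prod.swap] at h ⊢
    omega
  · rintro ⟨m, n⟩ h
    simp only [mem_vertexIndex] at h
    exact vertexTerm_reflect hg (by omega) k l r

theorem vertexSum_congr_parity (q z : F) (N : ℕ) {b c : ℕ} (h : b % 2 = c % 2) (k l r : ℤ) :
    vertexSum q z N b k l r = vertexSum q z N c k l r := by
  have : vertexIndex N b = vertexIndex N c := by
    ext p
    simp only [mem_vertexIndex, Nat.even_iff]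
    omega
  rw [vertexSum, vertexSum, this]

theorem ASet_finite (N : ℕ) (k l r : ℤ) : (ASet N k l r).Finite := by
  refine (Set.finite_Icc (0 : Fin N → ℤ) (fun _ => max k l)).subset ?_
  rintro a ⟨h0, hl, -, hk⟩
  refine ⟨h0, fun ⟨i, hi⟩ => ?_⟩
  cases i with
  | zero => exact (hl hi).trans (le_max_right _ _)
  | succ i =>
    have h1 := hk ⟨i, by omega⟩ hi
    have h2 := h0 ⟨i, by omega⟩
    exact le_max_of_le_left (by linarith)

theorem ASet_rev_mem {N : ℕ} {k l r : ℤ} {a : Fin N → ℤ} (ha : a ∈ ASet N k l r) :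
    a ∘ Fin.rev ∈ ASet N k r l := by
  obtain ⟨h0, hl, hr, hk⟩ := ha
  refine ⟨fun i => h0 _, fun h => ?_, fun h => ?_, fun t h => ?_⟩
  · rw [Function.comp_apply, show Fin.rev ⟨0, h⟩ = ⟨N - 1, Nat.sub_lt h Nat.one_pos⟩ from rfl]
    exact hr h
  · rw [Function.comp_apply, show Fin.rev ⟨N - 1, Nat.sub_lt h Nat.one_pos⟩ = ⟨0, h⟩ from
      Fin.ext (by simp only [Fin.val_rev]; omega)]
    exact hl h
  · have h1 := hk (Fin.rev ⟨t.1 + 1, h⟩) (by simp only [Fin.val_rev]; omega)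
    have h2 : (⟨(Fin.rev ⟨t.1 + 1, h⟩).1 + 1, by simp only [Fin.val_rev]; omega⟩ : Fin N) =
        Fin.rev t := Fin.ext (by simp only [Fin.val_rev]; omega)
    rw [h2, add_comm] at h1
    exact h1

theorem latticeSum_reflect {q z : F} (hg : IsGenericPair q z) (N : ℕ) (k l r : ℤ) :
    latticeSum q⁻¹ (q ^ (N + 1 : ℤ) * z) N k r l = latticeSum q z N k l r := by
  have hinv : ∀ a : Fin N → ℤ, (a ∘ Fin.rev) ∘ Fin.rev = a := fun a => by
    funext i
    simp
  refine (finsum_mem_eq_of_bijOn (fun a : Fin N → ℤ => a ∘ Fin.rev) ?_ ?_).symm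
  · exact Set.InvOn.bijOn (f' := fun a : Fin N → ℤ => a ∘ Fin.rev)
      ⟨fun a _ => hinv a, fun a _ => hinv a⟩ (fun a => ASet_rev_mem) (fun a => ASet_rev_mem)
  · exact fun a _ => (latticeMonomial_rev hg a).symm

theorem latticeSum_neg_one (q z : F) (N : ℕ) (k r : ℤ) :
    latticeSum q z (N + 1) k (-1) r = 0 := by
  have : ASet (N + 1) k (-1) r = ∅ := by
    ext a
    simp only [Set.mem_empty_iff_false, iff_false]
    rintro ⟨h0, hl, -, -⟩
    have h1 := h0 ⟨0, N.succ_pos⟩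
    have h2 := hl N.succ_pos
    omega
  rw [latticeSum, this, finsum_mem_empty]

theorem cons_mem_ASet {N : ℕ} {k l r : ℤ} (a : ℤ) (v : Fin N → ℤ) (h : N ≠ 0 ∨ a ≤ r) :
    (Fin.cons a v : Fin (N + 1) → ℤ) ∈ ASet (N + 1) k l r ↔
      0 ≤ a ∧ a ≤ l ∧ v ∈ ASet N k (k - a) r := by
  constructor
  · rintro ⟨h0, hl, hr, hk⟩
    refine ⟨h0 0, hl N.succ_pos, fun i => h0 i.succ, fun hN => ?_, fun hN => ?_,
      fun t ht => hk t.succ (Nat.succ_lt_succ ht)⟩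
    · have h1 : a + v ⟨0, hN⟩ ≤ k := hk 0 (Nat.succ_lt_succ hN)
      omega
    · cases N with
      | zero => exact absurd hN (lt_irrefl _)
      | succ N => exact hr (Nat.succ_pos _)
  · rintro ⟨ha0, hal, h0, hl, hr, hk⟩
    refine ⟨fun i => Fin.cases ha0 h0 i, fun _ => hal, fun _ => ?_, fun t => ?_⟩
    · cases N with
      | zero => exact h.resolve_left (fun h => h rfl)
      | succ N => exact hr N.succ_pos
    · refine Fin.cases (fun ht => ?_) (fun t ht => hk t (Nat.lt_of_succ_lt_succ ht)) t
      have h1 := hl (Nat.lt_of_succ_lt_succ ht)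
      change a + v ⟨0, Nat.lt_of_succ_lt_succ ht⟩ ≤ k
      omega

theorem latticeSum_succ_sub {q z : F} (hg : IsGenericPair q z) {N : ℕ} {k l r : ℤ}
    (hl : 0 ≤ l) (h : N ≠ 0 ∨ l ≤ r) :
    latticeSum q z (N + 1) k l r - latticeSum q z (N + 1) k (l - 1) r =
      (q * z) ^ l * latticeSum q (q * z) N k (k - l) r := by
  have hset : ASet (N + 1) k l r = ASet (N + 1) k (l - 1) r ∪
      (fun v : Fin N → ℤ => (Fin.cons l v : Fin (N + 1) → ℤ)) '' ASet N k (k - l) r := by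
    ext a
    refine Fin.consCases (fun a v => ?_) a
    have himage : (Fin.cons a v : Fin (N + 1) → ℤ) ∈
        (fun v : Fin N → ℤ => (Fin.cons l v : Fin (N + 1) → ℤ)) '' ASet N k (k - l) r ↔
        a = l ∧ v ∈ ASet N k (k - l) r := by
      constructor
      · rintro ⟨w, hw, hwv⟩
        obtain ⟨rfl, rfl⟩ := Fin.cons_injective2 hwv
        exact ⟨rfl, hw⟩
      · rintro ⟨rfl, hw⟩
        exact ⟨v, hw, rfl⟩
    rw [Set.mem_union, himage]
    by_cases ha : a ≤ l
    · have h' : N ≠ 0 ∨ a ≤ r := h.imp_right ha.trans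
      rw [cons_mem_ASet a v h', cons_mem_ASet a v h']
      constructor
      · rintro ⟨h0, -, hv⟩
        rcases ha.eq_or_lt with rfl | hlt
        · exact Or.inr ⟨rfl, hv⟩
        · exact Or.inl ⟨h0, by omega, hv⟩
      · rintro (⟨h0, -, hv⟩ | ⟨rfl, hv⟩)
        · exact ⟨h0, ha, hv⟩
        · exact ⟨hl, ha, hv⟩
    · constructor
      · intro hmem
        exact absurd (hmem.2.1 N.succ_pos) ha
      · rintro (hmem | ⟨rfl, -⟩)
        · have : a ≤ l - 1 := hmem.2.1 N.succ_pos
          omega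
        · exact absurd le_rfl ha
  have hdisj : Disjoint (ASet (N + 1) k (l - 1) r)
      ((fun v : Fin N → ℤ => (Fin.cons l v : Fin (N + 1) → ℤ)) '' ASet N k (k - l) r) := by
    rw [Set.disjoint_left]
    rintro _ hmem ⟨v, -, rfl⟩
    have : l ≤ l - 1 := hmem.2.1 N.succ_pos
    omega
  rw [latticeSum, latticeSum, latticeSum, hset,
    finsum_mem_union hdisj (ASet_finite _ _ _ _) ((ASet_finite _ _ _ _).image _),
    add_sub_cancel_left,
    finsum_mem_image (Fin.cons_right_injective (α := fun _ => ℤ) l).injOn,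
    mul_finsum_mem]
  exact finsum_mem_congr rfl fun v _ => latticeMonomial_cons hg l v

/-- The lattice sum equals the even vertex sum whenever `k ≤ l + r` (for `N` even) or
`r ≤ l` (for `N` odd). -/
def EvenFormula (F : Type*) [Field F] (N : ℕ) (k : ℤ) : Prop :=
  ∀ q z : F, IsGenericPair q z → ∀ l r : ℤ, 0 ≤ l → l ≤ k → 0 ≤ r → r ≤ k →
    (if Even N then k ≤ l + r else r ≤ l) → latticeSum q z N k l r = vertexSum q z N 0 k l r

/-- The lattice sum equals the odd vertex sum whenever `l + r ≤ k` (for `N` even) or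
`l ≤ r` (for `N` odd). -/
def OddFormula (F : Type*) [Field F] (N : ℕ) (k : ℤ) : Prop :=
  ∀ q z : F, IsGenericPair q z → ∀ l r : ℤ, 0 ≤ l → l ≤ k → 0 ≤ r → r ≤ k →
    (if Even N then l + r ≤ k else l ≤ r) → latticeSum q z N k l r = vertexSum q z N 1 k l r

theorem IsGenericPair.mul_left {q z : F} (h : IsGenericPair q z) : IsGenericPair q (q * z) := by
  simpa using h.shift 1

theorem evenFormula_zero (k : ℤ) : EvenFormula F 0 k := by
  intro q z _ l r _ _ _ _ _
  have hset : ASet 0 k l r = Set.univ := by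
    ext a
    simp [ASet]
  have hidx : vertexIndex 0 0 = {(0, 0)} := by decide
  rw [latticeSum, hset, vertexSum, hidx, finsum_mem_univ, finsum_unique]
  simp [vertexTerm, vertexDenom, latticeMonomial, phiQ, phiZ]

theorem EvenFormula.oddFormula_succ {N : ℕ} {k : ℤ} (hE : EvenFormula F N k) :
    OddFormula F (N + 1) k := by
  intro q z hg l r hl0 hlk hr0 hrk hcond
  have key : ∀ l : ℤ, -1 ≤ l → l ≤ k → (if Even (N + 1) then l + r ≤ k else l ≤ r) →
      latticeSum q z (N + 1) k l r = vertexSum q z (N + 1) 1 k l r := by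
    intro l hl
    induction l, hl using Int.leInduction with
    | base =>
      intro _ _
      rw [latticeSum_neg_one, vertexSum_neg_one hg]
    | succ l hl ih =>
      intro hlk hc
      have ih' := ih (by omega) (by split_ifs at hc ⊢ <;> omega)
      have h1 : N ≠ 0 ∨ l + 1 ≤ r := by
        rcases eq_or_ne N 0 with rfl | h0
        · exact Or.inr (by simpa using hc)
        · exact Or.inl h0
      have hp := latticeSum_succ_sub hg (k := k) (show 0 ≤ l + 1 by omega) h1
      have hd := vertexSum_succ_sub hg N 1 k (l + 1) r
      rw [add_sub_cancel_right] at hp hd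
      rw [vertexSum_congr_parity q (q * z) N (show (1 + 1) % 2 = 0 % 2 from rfl),
        ← hE q (q * z) hg.mul_left (k - (l + 1)) r (by omega) (by omega) hr0 hrk
          (by simp only [Nat.even_add_one] at hc; split_ifs at hc ⊢ <;> omega)]
        at hd
      linear_combination hp - hd + ih'
  exact key l (by omega) hlk hcond

theorem OddFormula.evenFormula_of_odd {N : ℕ} {k : ℤ} (hN : Odd N) (hO : OddFormula F N k) :
    EvenFormula F N k := by
  intro q z hg l r hl0 hlk hr0 hrk hcond
  rw [← latticeSum_reflect hg, ← vertexSum_reflect hg,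
    vertexSum_congr_parity _ _ N (show (0 + N) % 2 = 1 % 2 by rw [zero_add, Nat.odd_iff.1 hN])]
  refine hO _ _ (hg.reflect N) r l hr0 hrk hl0 hlk ?_
  simpa [Nat.not_even_iff_odd.2 hN] using hcond

theorem vertexSum_eq_add_boundary (q z : F) (N b : ℕ) (k l r : ℤ) :
    vertexSum q z N b k l r =
      (∑ p ∈ (Finset.range (N + 1) ×ˢ Finset.range (N + 1)).filter (fun p => p.1 + p.2 < N),
        vertexTerm q z N k l r p.1 p.2) +
      ∑ p ∈ Finset.HasAntidiagonal.antidiagonal N,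
        if Even (p.1 + b) then vertexTerm q z N k l r p.1 p.2 else 0 := by
  rw [← Finset.sum_filter, ← Finset.sum_union, vertexSum]
  · congr 1
    ext p
    simp only [mem_vertexIndex, Finset.mem_union, Finset.mem_filter, Finset.mem_product,
      Finset.mem_range, Finset.HasAntidiagonal.mem_antidiagonal, Nat.even_iff]
    omega
  · rw [Finset.disjoint_left]
    intro p
    simp only [Finset.mem_filter, Finset.HasAntidiagonal.mem_antidiagonal]
    omega

theorem vertexSum_sub_diagonal {q z : F} {N : ℕ} (hN : Even N) (k l : ℤ) :
    vertexSum q z N 0 k l (k - l) - vertexSum q z N 1 k l (k - l) =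
      latticeMonomial q z (Mvec N k l 0 N 0) *
        ∑ p ∈ Finset.HasAntidiagonal.antidiagonal N, (-1) ^ p.1 / vertexDenom q z N p.1 p.2 := by
  rw [vertexSum_eq_add_boundary, vertexSum_eq_add_boundary, add_sub_add_left_eq_sub,
    ← Finset.sum_sub_distrib, Finset.mul_sum]
  refine Finset.sum_congr rfl ?_
  rintro ⟨m, n⟩ h
  rw [Finset.HasAntidiagonal.mem_antidiagonal] at h
  have hv : Mvec N k l (k - l) m n = Mvec N k l 0 N 0 := by
    funext j
    have hj := j.2
    rw [Nat.even_iff] at hN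
    simp only [Mvec] at h ⊢
    split_ifs <;> omega
  simp only [vertexTerm, hv]
  rcases Nat.even_or_odd m with hm | hm
  · simp [hm, Nat.even_add_one, hm.neg_one_pow, div_eq_mul_inv]
  · simp [Nat.not_even_iff_odd.2 hm, Nat.even_add_one, hm.neg_one_pow, div_eq_mul_inv]

theorem OddFormula.defect_left {M : ℕ} {k : ℤ} (hM : Odd M) (hO : OddFormula F M k) {q z : F}
    (hg : IsGenericPair q z) {l r : ℤ} (hl0 : 0 ≤ l) (hlk : l + 1 ≤ k) (hr0 : 0 ≤ r)
    (hrk : r ≤ k) (hlr : k ≤ l + r) :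
    latticeSum q z (M + 1) k (l + 1) r - vertexSum q z (M + 1) 0 k (l + 1) r =
      latticeSum q z (M + 1) k l r - vertexSum q z (M + 1) 0 k l r := by
  have hp := latticeSum_succ_sub hg (N := M) (k := k) (r := r) (show 0 ≤ l + 1 by omega)
    (Or.inl hM.pos.ne')
  have hd := vertexSum_succ_sub hg M 0 k (l + 1) r
  rw [add_sub_cancel_right] at hp hd
  rw [zero_add, ← hO q (q * z) hg.mul_left (k - (l + 1)) r (by omega) (by omega) hr0 hrk
    (by rw [if_neg (Nat.not_even_iff_odd.2 hM)]; omega)] at hd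
  linear_combination hp - hd

theorem OddFormula.defect_right {M : ℕ} {k : ℤ} (hM : Odd M) (hO : OddFormula F M k) {q z : F}
    (hg : IsGenericPair q z) {l r : ℤ} (hl0 : 0 ≤ l) (hlk : l ≤ k) (hr0 : 0 ≤ r)
    (hrk : r + 1 ≤ k) (hlr : k ≤ l + r) :
    latticeSum q z (M + 1) k l (r + 1) - vertexSum q z (M + 1) 0 k l (r + 1) =
      latticeSum q z (M + 1) k l r - vertexSum q z (M + 1) 0 k l r := by
  have hpar : (0 + (M + 1)) % 2 = 0 % 2 := by
    rw [Nat.odd_iff] at hM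
    omega
  have := hO.defect_left hM (hg.reflect (M + 1)) hr0 hrk hl0 hlk (by omega)
  rwa [latticeSum_reflect hg, latticeSum_reflect hg,
    ← vertexSum_congr_parity _ _ (M + 1) hpar, ← vertexSum_congr_parity _ _ (M + 1) hpar,
    vertexSum_reflect hg, vertexSum_reflect hg] at this

theorem OddFormula.evenFormula_succ {M : ℕ} {k : ℤ} (hk : 1 ≤ k) (hM : Odd M)
    (hO : OddFormula F M k) (hO' : OddFormula F (M + 1) k) : EvenFormula F (M + 1) k := by
  intro q z hg l r hl0 hlk hr0 hrk hcond
  have hN : Even (M + 1) := hM.add_one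
  rw [if_pos hN] at hcond
  set R := ∑ p ∈ Finset.HasAntidiagonal.antidiagonal (M + 1),
    (-1 : F) ^ p.1 / vertexDenom q z (M + 1) p.1 p.2 with hR
  have hdiag : ∀ l : ℤ, 0 ≤ l → l ≤ k →
      latticeSum q z (M + 1) k l (k - l) - vertexSum q z (M + 1) 0 k l (k - l) =
        -(latticeMonomial q z (Mvec (M + 1) k l 0 (M + 1) 0) * R) := by
    intro l hl0 hlk
    rw [hR, ← vertexSum_sub_diagonal hN, hO' q z hg l (k - l) hl0 hlk (by omega) (by omega)
      (by rw [if_pos hN]; omega)]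
    ring
  have hR0 : R = 0 := by
    have h0 := hdiag 0 le_rfl (by omega)
    have h1 := hdiag 1 (by omega) hk
    have hleft := hO.defect_left hM hg (le_refl 0) (by omega) (show 0 ≤ k by omega) le_rfl
      (by omega)
    have hright := hO.defect_right hM hg (l := 1) (r := k - 1) (by omega) hk (by omega)
      (by omega) (by omega)
    rw [sub_add_cancel] at hright
    rw [zero_add] at hleft
    rw [sub_zero] at h0
    have heq : latticeMonomial q z (Mvec (M + 1) k 1 0 (M + 1) 0) * R =
        latticeMonomial q z (Mvec (M + 1) k 0 0 (M + 1) 0) * R := by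
      linear_combination h1 - h0 + hright - hleft
    rw [Mvec_pred_left, latticeMonomial_add hg, sub_self, mul_assoc] at heq
    have heq' := mul_left_cancel₀ (latticeMonomial_ne_zero hg _) heq
    by_contra hne
    exact latticeMonomial_altVec_ne_one hg le_rfl (Nat.succ_ne_zero M)
      (mul_right_cancel₀ hne (heq'.trans (one_mul R).symm))
  have key : ∀ l : ℤ, k - r ≤ l → l ≤ k →
      latticeSum q z (M + 1) k l r - vertexSum q z (M + 1) 0 k l r = 0 := by
    intro l hl
    induction l, hl using Int.leInduction with
    | base =>
      intro _
      have := hdiag (k - r) (by omega) (by omega)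
      rwa [sub_sub_cancel, hR0, mul_zero, neg_zero] at this
    | succ l hl ih =>
      intro hlk
      rw [hO.defect_left hM hg (by omega) hlk hr0 hrk (by omega), ih (by omega)]
  exact sub_eq_zero.1 (key l (by omega) hlk)

theorem oddFormula_and_evenFormula {k : ℤ} (hk : 1 ≤ k) (N : ℕ) :
    (N ≠ 0 → OddFormula F N k) ∧ EvenFormula F N k := by
  induction N with
  | zero => exact ⟨fun h => absurd rfl h, evenFormula_zero k⟩
  | succ N ih =>
    have hO := ih.2.oddFormula_succ
    refine ⟨fun _ => hO, ?_⟩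
    rcases Nat.even_or_odd N with hN | hN
    · exact hO.evenFormula_of_odd hN.add_one
    · exact (ih.1 hN.pos.ne').evenFormula_succ hk hN hO

theorem isGenericPair_qK_zK : IsGenericPair qK zK where
  q_ne_zero := by simp [qK]
  z_ne_zero := by simp [zK]
  pow_ne_one i hi h := by
    rw [qK, ← map_pow, ← map_one (algebraMap (MvPolynomial (Fin 2) ℚ) K),
      (IsFractionRing.injective _ K).eq_iff] at h
    have := congrArg (MvPolynomial.eval 0) h
    simp [hi] at this
  zpow_mul_ne_one i h := by
    obtain ⟨n, rfl | rfl⟩ := i.eq_nat_or_neg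
    · rw [zpow_natCast, qK, zK, ← map_pow, ← map_mul,
        ← map_one (algebraMap (MvPolynomial (Fin 2) ℚ) K),
        (IsFractionRing.injective _ K).eq_iff] at h
      have := congrArg (MvPolynomial.eval 0) h
      simp at this
    · have hq : qK ^ n ≠ 0 := pow_ne_zero _ (by simp [qK])
      rw [zpow_neg, zpow_natCast, inv_mul_eq_one₀ hq, qK, zK, ← map_pow,
        (IsFractionRing.injective _ K).eq_iff] at h
      have := congrArg (MvPolynomial.eval ![1, 0]) h
      simp at this

theorem lattice_gen_poly_eq_dO_even (N : ℕ) (hN : 2 ≤ N) (hNeven : Even N)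
    (k l r : ℤ) (hk : 1 ≤ k) (hl0 : 0 ≤ l) (hlk : l ≤ k) (hr0 : 0 ≤ r) (hrk : r ≤ k)
    (hlr : l + r ≤ k) :
    pPoly N k l r = dO N k l r := by
  have hodd : dO N k l r = vertexSum qK zK N 1 k l r := by
    simp only [dO, vertexSum, vertexIndex, Nat.even_add_one, Nat.not_even_iff_odd]
    rfl
  rw [hodd]
  exact (oddFormula_and_evenFormula hk N).1 (by omega) qK zK isGenericPair_qK_zK l r hl0 hlk hr0 hrk
    (by rwa [if_pos hNeven])

end
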